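/- Let K be an algebraically closed field and let S ⊆ K^m × K^n be a constructible set with respect to the Zariski topology on K^{m+n}. Then the set { (a, x) ∈ K^m × K^n : x belongs to the Zariski closure of the fiber S_a in K^n } is a constructible subset of K^m × K^n. (This is Theorem A.6(1) of the paper's appendix: Zariski closure is definable in families over algebraically closed fields.) -/

import Mathlib

/-- The Zariski topology on affine space `σ → K`: the closed sets are the common
zero loci of sets of polynomials over `K`. -/
def zariskiTopology (K : Type*) [CommRing K] (σ : Type*) :
    TopologicalSpace (σ → K) :=
  TopologicalSpace.generateFrom
    {U | ∃ f : MvPolynomial σ K, U = {x | MvPolynomial.eval x f ≠ 0}}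

/-- A set is constructible w.r.t. a topology `t` if it is a finite union of
differences of `t`-closed sets (equivalently, a finite Boolean combination of
closed sets). -/
def IsConstructibleIn {α : Type*} (t : TopologicalSpace α) (S : Set α) : Prop :=
  ∃ (r : ℕ) (C D : Fin r → Set α),
    (∀ i, @IsClosed _ t (C i)) ∧ (∀ i, @IsClosed _ t (D i)) ∧
    S = ⋃ i, C i \ D i

open MvPolynomial

section Algebra

variable {σ A : Type*} [CommRing A]

/-- Every ideal of a polynomial ring in finitely many variables contains finitely many nonzero
elements whose leading exponents divide all leading exponents of the ideal. -/
theorem MonomialOrder.exists_finset_degree_le [Finite σ] (mo : MonomialOrder σ)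
    (N : Ideal (MvPolynomial σ A)) :
    ∃ s : Finset (MvPolynomial σ A), (∀ g ∈ s, g ∈ N ∧ g ≠ 0) ∧
      ∀ p ∈ N, p ≠ 0 → ∃ g ∈ s, mo.degree g ≤ mo.degree p := by
  classical
  let D : Set (σ →₀ ℕ) := {d | ∃ p ∈ N, p ≠ 0 ∧ mo.degree p = d}
  have hD : D.IsPWO := Set.isPWO_of_wellQuasiOrderedLE D
  have hfin : {d | Minimal (· ∈ D) d}.Finite :=
    IsAntichain.finite_of_partiallyWellOrderedOn (setOfPred_minimal_antichain (· ∈ D))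
      (hD.mono fun d hd => hd.prop)
  have hex : ∀ d ∈ D, ∃ p ∈ N, p ≠ 0 ∧ mo.degree p = d := fun d hd => hd
  choose! b hbN hb0 hbd using hex
  refine ⟨hfin.toFinset.image b, ?_, ?_⟩
  · intro g hg
    obtain ⟨d, hd, rfl⟩ := Finset.mem_image.1 hg
    have hd' : d ∈ D := ((hfin.mem_toFinset).1 hd).prop
    exact ⟨hbN d hd', hb0 d hd'⟩
  · intro p hp hp0
    obtain ⟨d, hle, hd⟩ := hD.exists_le_minimal (a := mo.degree p) ⟨p, hp, hp0, rfl⟩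
    exact ⟨b d, Finset.mem_image_of_mem b (hfin.mem_toFinset.2 hd), by rwa [hbd d hd.prop]⟩

/-- Generic purity: for an ideal `N` of a polynomial ring over a domain `A`, after inverting a
single nonzero element `h` of `A`, the intersection of `N` with the extension of the kernel of a
specialization is the product of the two ideals. -/
theorem MvPolynomial.exists_pow_mul_mem_ker_mul [Finite σ] [IsDomain A]
    (N : Ideal (MvPolynomial σ A)) :
    ∃ h : A, h ≠ 0 ∧ ∀ {k : Type*} [Field k] (φ : A →+* k), ∀ p ∈ N, map φ p = 0 →
      ∃ r : ℕ, C h ^ r * p ∈ RingHom.ker (map (σ := σ) φ) * N := by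
  classical
  let : LinearOrder σ := WellOrderingRel.isWellOrder.linearOrder
  let mo : MonomialOrder σ := MonomialOrder.lex
  obtain ⟨s, hs, hdeg⟩ := mo.exists_finset_degree_le N
  refine ⟨∏ g ∈ s, mo.leadingCoeff g, ?_, ?_⟩
  · exact Finset.prod_ne_zero_iff.2 fun g hg => mo.leadingCoeff_ne_zero_iff.2 (hs g hg).2
  intro k _ φ
  suffices H : ∀ d : mo.syn, ∀ p ∈ N, mo.toSyn (mo.degree p) = d → map φ p = 0 →
      ∃ r : ℕ, C (∏ g ∈ s, mo.leadingCoeff g) ^ r * p ∈ RingHom.ker (map (σ := σ) φ) * N from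
    fun p hp => H _ p hp rfl
  intro d
  induction d using WellFoundedLT.induction with
  | ind d ih =>
  intro p hp hpd hφ
  by_cases hp0 : p = 0
  · exact ⟨0, by simp [hp0]⟩
  obtain ⟨g, hg, hle⟩ := hdeg p hp hp0
  have hS : mo.sPolynomial p g = C (mo.leadingCoeff g) * p -
      monomial (mo.degree p - mo.degree g) (mo.leadingCoeff p) * g := by
    rw [MonomialOrder.sPolynomial, tsub_eq_zero_of_le hle]; rfl
  have hlc : φ (mo.leadingCoeff p) = 0 := by
    rw [MonomialOrder.leadingCoeff, ← coeff_map, hφ, coeff_zero]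
  have hmon : monomial (mo.degree p - mo.degree g) (mo.leadingCoeff p) * g ∈
      RingHom.ker (map (σ := σ) φ) * N :=
    Ideal.mul_mem_mul (by rw [RingHom.mem_ker, map_monomial, hlc, map_zero]) (hs g hg).1
  obtain ⟨c, hc⟩ : mo.leadingCoeff g ∣ ∏ g ∈ s, mo.leadingCoeff g := Finset.dvd_prod_of_mem _ hg
  have hSr : ∃ r : ℕ, C (∏ g ∈ s, mo.leadingCoeff g) ^ r * mo.sPolynomial p g ∈
      RingHom.ker (map (σ := σ) φ) * N := by
    by_cases hS0 : mo.sPolynomial p g = 0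
    · exact ⟨0, by simp [hS0]⟩
    refine ih _ ?_ _ ?_ rfl ?_
    · have := mo.degree_sPolynomial_lt_sup_degree hS0
      rwa [sup_eq_left.2 hle, hpd] at this
    · rw [hS]
      exact N.sub_mem (N.mul_mem_left _ hp) (N.mul_mem_left _ (hs g hg).1)
    · rw [hS, map_sub, map_mul, hφ, mul_zero, map_mul, map_monomial, hlc, map_zero, zero_mul,
        sub_zero]
  obtain ⟨r, hr⟩ := hSr
  refine ⟨r + 1, ?_⟩
  have : C (∏ g ∈ s, mo.leadingCoeff g) ^ (r + 1) * p =
      C c * (C (∏ g ∈ s, mo.leadingCoeff g) ^ r * mo.sPolynomial p g) +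
      C (∏ g ∈ s, mo.leadingCoeff g) ^ r * C c *
        (monomial (mo.degree p - mo.degree g) (mo.leadingCoeff p) * g) := by
    rw [hS, pow_succ]
    nth_rewrite 2 [hc]
    rw [C_mul]
    ring
  rw [this]
  exact Ideal.add_mem _ (Ideal.mul_mem_left _ _ hr) (Ideal.mul_mem_left _ _ hmon)

/-- Saturation with respect to an element is preserved by generic specialization. -/
theorem MvPolynomial.exists_saturated_map [Finite σ] [IsDomain A]
    (J : Ideal (MvPolynomial σ A)) (g : MvPolynomial σ A) (hJ : ∀ p, g * p ∈ J → p ∈ J) :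
    ∃ h : A, h ≠ 0 ∧ ∀ {k : Type*} [Field k] (φ : A →+* k), Function.Surjective φ → φ h ≠ 0 →
      ∀ f, map φ g * f ∈ J.map (map φ) → f ∈ J.map (map φ) := by
  obtain ⟨h, h0, H⟩ := exists_pow_mul_mem_ker_mul (J ⊔ Ideal.span {g})
  refine ⟨h, h0, fun {k} _ φ hφ hh f hf => ?_⟩
  have hsurj := map_surjective (σ := σ) φ hφ
  obtain ⟨F, rfl⟩ := hsurj f
  obtain ⟨j, hj, hjF⟩ := (Ideal.mem_map_iff_of_surjective _ hsurj).1 hf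
  obtain ⟨r, hr⟩ := H φ (g * F - j)
    (Ideal.sub_mem _ (Ideal.mul_mem_right _ _ (Ideal.mem_sup_right
      (Ideal.mem_span_singleton_self g)))
      (Ideal.mem_sup_left hj)) (by rw [map_sub, map_mul, hjF, sub_self])
  rw [Ideal.mul_sup, Submodule.mem_sup] at hr
  obtain ⟨u, hu, v, hv, huv⟩ := hr
  obtain ⟨c, hc, rfl⟩ := Ideal.mem_mul_span_singleton.1 hv
  have huJ : u ∈ J := (Ideal.mul_le_inf hu).2
  have hmem : C h ^ r * F - c ∈ J := by
    refine hJ _ ?_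
    have : g * (C h ^ r * F - c) = u + C h ^ r * j := by linear_combination -huv
    rw [this]
    exact J.add_mem huJ (J.mul_mem_left _ hj)
  have hm := Ideal.mem_map_of_mem (map φ) hmem
  rw [map_sub, RingHom.mem_ker.1 hc, sub_zero, map_mul, map_pow, map_C] at hm
  refine (Ideal.unit_mul_mem_iff_mem _ ?_).1 hm
  exact ((IsUnit.mk0 _ hh).map C).pow r

end Algebra

section Zariski

variable {K : Type*} [Field K] {σ τ : Type*}

theorem isClosed_zariskiTopology_iff {Z : Set (σ → K)} :
    @IsClosed _ (zariskiTopology K σ) Z ↔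
      ∃ P : Set (MvPolynomial σ K), Z = {x | ∀ p ∈ P, eval x p = 0} := by
  let := zariskiTopology K σ
  constructor
  · intro hZ
    suffices H : ∀ U : Set (σ → K), IsOpen U →
        ∃ P : Set (MvPolynomial σ K), Uᶜ = {x | ∀ p ∈ P, eval x p = 0} by
      simpa using H Zᶜ hZ.isOpen_compl
    intro U hU
    induction hU with
    | basic U hU =>
      obtain ⟨f, rfl⟩ := hU
      exact ⟨{f}, by ext x; simp⟩
    | univ => exact ⟨{1}, by ext x; simp⟩
    | inter U V _ _ hU hV =>
      obtain ⟨P, hP⟩ := hU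
      obtain ⟨Q, hQ⟩ := hV
      refine ⟨Set.image2 (· * ·) P Q, ?_⟩
      rw [Set.compl_inter, hP, hQ]
      ext x
      simp only [Set.mem_union, Set.mem_ofPred_eq, Set.forall_mem_image2, map_mul, mul_eq_zero]
      constructor
      · rintro (h | h) p hp q hq
        exacts [Or.inl (h p hp), Or.inr (h q hq)]
      · intro h
        by_contra! h'
        obtain ⟨⟨p, hp, hpx⟩, q, hq, hqx⟩ := h'
        exact (h p hp q hq).elim hpx hqx
    | sUnion 𝒰 _ h =>
      choose! P hP using h
      refine ⟨⋃ U ∈ 𝒰, P U, ?_⟩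
      have key : ∀ U ∈ 𝒰, ∀ x, x ∉ U ↔ ∀ p ∈ P U, eval x p = 0 := fun U hU x =>
        Set.ext_iff.1 (hP U hU) x
      ext x
      simp only [Set.mem_compl_iff, Set.mem_sUnion, not_exists, not_and, Set.mem_ofPred_eq,
        Set.mem_iUnion, forall_exists_index]
      constructor
      · intro hx p U hU hp
        exact (key U hU x).1 (hx U hU) p hp
      · intro hx U hU
        exact (key U hU x).2 fun p hp => hx p U hU hp
  · rintro ⟨P, rfl⟩
    have : {x : σ → K | ∀ p ∈ P, eval x p = 0} = ⋂ p ∈ P, {x | eval x p = 0} := by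
      ext x; simp
    rw [this]
    refine isClosed_biInter fun p _ => ⟨?_⟩
    exact TopologicalSpace.isOpen_generateFrom_of_mem ⟨p, rfl⟩

theorem mem_closure_zariskiTopology_iff {Z : Set (σ → K)} {x : σ → K} :
    x ∈ @closure _ (zariskiTopology K σ) Z ↔
      ∀ f : MvPolynomial σ K, (∀ z ∈ Z, eval z f = 0) → eval x f = 0 := by
  let := zariskiTopology K σ
  constructor
  · intro hx f hf
    exact closure_minimal (t := {z | eval z f = 0}) hf
      (isClosed_zariskiTopology_iff.2 ⟨{f}, by simp⟩) hx
  · intro h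
    obtain ⟨P, hP⟩ := isClosed_zariskiTopology_iff.1 (isClosed_closure (s := Z))
    have key : ∀ z, z ∈ closure Z ↔ ∀ p ∈ P, eval z p = 0 := Set.ext_iff.1 hP
    exact (key x).2 fun p hp => h p fun z hz => (key z).1 (subset_closure hz) p hp

/-- Evaluation at `y` of a polynomial in the variables `σ` over the polynomials in `τ` is
evaluation of a polynomial in the variables `τ ⊕ σ`. -/
theorem exists_eval_eq_eval_map_eval (p : MvPolynomial σ (MvPolynomial τ K)) :
    ∃ q : MvPolynomial (τ ⊕ σ) K, ∀ y : τ ⊕ σ → K,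
      eval y q = eval (fun i => y (Sum.inr i)) (map (eval fun i => y (Sum.inl i)) p) := by
  refine ⟨eval₂ (rename Sum.inl).toRingHom (fun i => X (Sum.inr i)) p, fun y => ?_⟩
  induction p using MvPolynomial.induction_on with
  | C a => simp [eval_rename, Function.comp_def]
  | add p q hp hq => simp_all
  | mul_X p i hp => simp_all

theorem exists_eval_map_eval_eq_eval (q : MvPolynomial (τ ⊕ σ) K) :
    ∃ p : MvPolynomial σ (MvPolynomial τ K), ∀ y : τ ⊕ σ → K,
      eval (fun i => y (Sum.inr i)) (map (eval fun i => y (Sum.inl i)) p) = eval y q := by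
  refine ⟨eval₂ (C.comp C) (Sum.elim (fun i => C (X i)) X) q, fun y => ?_⟩
  induction q using MvPolynomial.induction_on with
  | C a => simp
  | add p q hp hq => simp_all
  | mul_X p i hp => cases i <;> simp_all

theorem isClosed_setOf_eval_map_eval (J : Set (MvPolynomial σ (MvPolynomial τ K))) :
    @IsClosed _ (zariskiTopology K (τ ⊕ σ)) {y | ∀ j ∈ J,
      eval (fun i => y (Sum.inr i)) (map (eval fun i => y (Sum.inl i)) j) = 0} := by
  choose q hq using exists_eval_eq_eval_map_eval (K := K) (σ := σ) (τ := τ)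
  refine isClosed_zariskiTopology_iff.2 ⟨q '' J, ?_⟩
  ext y
  simp [hq]

theorem isClosed_setOf_eval_comp_inl (P : Set (MvPolynomial τ K)) :
    @IsClosed _ (zariskiTopology K (τ ⊕ σ)) {y | ∀ p ∈ P, eval (fun i => y (Sum.inl i)) p = 0} := by
  convert isClosed_setOf_eval_map_eval (K := K) (σ := σ) (C '' P) using 1
  ext y
  simp

end Zariski

section Constructible

variable {α : Type*} {t : TopologicalSpace α}

theorem IsConstructibleIn.of_isClosed_diff {C D : Set α} (hC : @IsClosed _ t C)
    (hD : @IsClosed _ t D) : IsConstructibleIn t (C \ D) :=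
  ⟨1, fun _ => C, fun _ => D, fun _ => hC, fun _ => hD, by simp [Set.iUnion_const]⟩

theorem IsConstructibleIn.iUnion {ι : Type*} [Finite ι] {S : ι → Set α}
    (h : ∀ i, IsConstructibleIn t (S i)) : IsConstructibleIn t (⋃ i, S i) := by
  choose r C D hC hD hS using h
  obtain ⟨N, ⟨e⟩⟩ := Finite.exists_equiv_fin (Σ i, Fin (r i))
  refine ⟨N, fun k => C _ (e.symm k).2, fun k => D _ (e.symm k).2, fun k => hC _ _,
    fun k => hD _ _, ?_⟩
  rw [e.symm.surjective.iUnion_comp fun x : Σ i, Fin (r i) => C x.1 x.2 \ D x.1 x.2,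
    Set.iUnion_sigma]
  exact Set.iUnion_congr hS

theorem IsConstructibleIn.union {S T : Set α} (hS : IsConstructibleIn t S)
    (hT : IsConstructibleIn t T) : IsConstructibleIn t (S ∪ T) := by
  rw [Set.union_eq_iUnion]
  exact .iUnion fun b => by cases b <;> assumption

end Constructible

section Families

variable {K : Type*} [Field K] [IsAlgClosed K] {σ τ : Type*} [Finite σ]

/-- Over a nonempty open part of an irreducible parameter space, the Zariski closures of the
fibers of a family of basic locally closed sets form a family of closed sets. -/
theorem exists_closure_fiber_eq_zeroLocus (I : Ideal (MvPolynomial τ K)) [I.IsPrime]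
    (P : Set (MvPolynomial σ (MvPolynomial τ K))) (g : MvPolynomial σ (MvPolynomial τ K)) :
    ∃ h ∉ I, ∃ J : Set (MvPolynomial σ (MvPolynomial τ K)), ∀ a : τ → K,
      (∀ p ∈ I, eval a p = 0) → eval a h ≠ 0 →
      @closure _ (zariskiTopology K σ)
        {z | (∀ p ∈ P, eval z (map (eval a) p) = 0) ∧ eval z (map (eval a) g) ≠ 0} =
      {x | ∀ j ∈ J, eval x (map (eval a) j) = 0} := by
  let A := MvPolynomial τ K ⧸ I
  let π : MvPolynomial τ K →+* A := Ideal.Quotient.mk I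
  have hπ : Function.Surjective (map (σ := σ) π) := map_surjective π Ideal.Quotient.mk_surjective
  let I₀ : Ideal (MvPolynomial σ A) := Ideal.span (map π '' P)
  let g₀ : MvPolynomial σ A := map π g
  obtain ⟨J₀, hJ₀⟩ : ∃ J₀ : Ideal (MvPolynomial σ A), ∀ p, p ∈ J₀ ↔ ∃ s, g₀ ^ s * p ∈ I₀ := by
    refine ⟨{ carrier := {p | ∃ s, g₀ ^ s * p ∈ I₀}, zero_mem' := ⟨0, by simp⟩,
              add_mem' := ?_, smul_mem' := ?_ }, fun p => Iff.rfl⟩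
    · rintro p q ⟨s, hs⟩ ⟨s', hs'⟩
      refine ⟨s + s', ?_⟩
      have : g₀ ^ (s + s') * (p + q) = g₀ ^ s' * (g₀ ^ s * p) + g₀ ^ s * (g₀ ^ s' * q) := by ring
      rw [this]
      exact I₀.add_mem (I₀.mul_mem_left _ hs) (I₀.mul_mem_left _ hs')
    · rintro c p ⟨s, hs⟩
      refine ⟨s, ?_⟩
      rw [smul_eq_mul, mul_left_comm]
      exact I₀.mul_mem_left _ hs
  have hsat : ∀ p, g₀ * p ∈ J₀ → p ∈ J₀ := by
    intro p hp
    obtain ⟨s, hs⟩ := (hJ₀ _).1 hp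
    exact (hJ₀ _).2 ⟨s + 1, by rwa [pow_succ, mul_assoc]⟩
  obtain ⟨h₀, hh₀, H⟩ := exists_saturated_map J₀ g₀ hsat
  obtain ⟨h, rfl⟩ := Ideal.Quotient.mk_surjective h₀
  refine ⟨h, fun hI => hh₀ (Ideal.Quotient.eq_zero_iff_mem.2 hI), {j | map π j ∈ J₀}, ?_⟩
  intro a ha hha
  let φ : A →+* K := Ideal.Quotient.lift I (eval a) ha
  have hφπ : φ.comp π = eval a := Ideal.Quotient.lift_comp_mk I (eval a) ha
  have hφ : Function.Surjective φ := fun c => ⟨π (C c), by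
    rw [← RingHom.comp_apply, hφπ, eval_C]⟩
  have hmap : ∀ p : MvPolynomial σ (MvPolynomial τ K), map φ (map π p) = map (eval a) p := by
    intro p
    rw [map_map, hφπ]
  have hI₀ : ∀ z : σ → K, (∀ p ∈ P, eval z (map (eval a) p) = 0) ↔
      ∀ f ∈ I₀.map (map φ), eval z f = 0 := by
    intro z
    have h1 : I₀.map (map φ) = Ideal.span (map (eval a) '' P) := by
      simp only [I₀, Ideal.map_span, Set.image_image, hmap]
    have h2 : (∀ f ∈ I₀.map (map φ), eval z f = 0) ↔
        I₀.map (map φ) ≤ RingHom.ker (eval z) := Iff.rfl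
    rw [h2, h1, Ideal.span_le, Set.image_subset_iff]
    rfl
  have hIJ : I₀.map (map φ) ≤ J₀.map (map φ) :=
    Ideal.map_mono fun p hp => (hJ₀ p).2 ⟨0, by simpa using hp⟩
  have Hpow : ∀ (s : ℕ) (f : MvPolynomial σ K), map (eval a) g ^ s * f ∈ J₀.map (map φ) →
      f ∈ J₀.map (map φ) := by
    intro s
    induction s with
    | zero => simp
    | succ s ih =>
      intro f hf
      rw [pow_succ, mul_assoc] at hf
      have := ih _ hf
      rw [← hmap] at this
      exact H φ hφ (by rwa [← RingHom.comp_apply, hφπ]) f this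
  ext x
  rw [mem_closure_zariskiTopology_iff, Set.mem_ofPred_eq]
  constructor
  · intro hx j hj
    refine hx _ ?_
    rintro z ⟨hzP, hzg⟩
    obtain ⟨s, hs⟩ := (hJ₀ _).1 hj
    have := (hI₀ z).1 hzP _ (Ideal.mem_map_of_mem _ hs)
    rw [map_mul, map_pow, hmap, hmap, map_mul, map_pow] at this
    exact (mul_eq_zero.1 this).resolve_left (pow_ne_zero _ hzg)
  · intro hx f hf
    have hfg : map (eval a) g * f ∈ (I₀.map (map φ)).radical := by
      rw [← vanishingIdeal_zeroLocus_eq_radical (K := K), mem_vanishingIdeal_iff]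
      intro z hz
      rw [mem_zeroLocus_iff] at hz
      simp only [aeval_eq_eval] at hz ⊢
      rw [map_mul]
      by_cases hzg : eval z (map (eval a) g) = 0
      · rw [hzg, zero_mul]
      · rw [hf z ⟨(hI₀ z).2 hz, hzg⟩, mul_zero]
    obtain ⟨s, hs⟩ := hfg
    rw [mul_pow] at hs
    obtain ⟨F, hF, hFf⟩ := (Ideal.mem_map_iff_of_surjective _ (map_surjective φ hφ)).1
      (Hpow s _ (hIJ hs))
    obtain ⟨F, rfl⟩ := hπ F
    have := hx F hF
    rw [← hmap, hFf, map_pow] at this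
    exact eq_zero_of_pow_eq_zero this

theorem isConstructibleIn_closure_fiber_basic [Finite τ]
    (P : Set (MvPolynomial σ (MvPolynomial τ K))) (g : MvPolynomial σ (MvPolynomial τ K)) :
    IsConstructibleIn (zariskiTopology K (τ ⊕ σ))
      {y : τ ⊕ σ → K | (fun i => y (Sum.inr i)) ∈ @closure _ (zariskiTopology K σ)
        {z | (∀ p ∈ P, eval z (map (eval fun i => y (Sum.inl i)) p) = 0) ∧
          eval z (map (eval fun i => y (Sum.inl i)) g) ≠ 0}} := by
  set T := {y : τ ⊕ σ → K | (fun i => y (Sum.inr i)) ∈ @closure _ (zariskiTopology K σ)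
        {z | (∀ p ∈ P, eval z (map (eval fun i => y (Sum.inl i)) p) = 0) ∧
          eval z (map (eval fun i => y (Sum.inl i)) g) ≠ 0}} with hT
  let V : Ideal (MvPolynomial τ K) → Set (τ ⊕ σ → K) :=
    fun I => {y | ∀ p ∈ I, eval (fun i => y (Sum.inl i)) p = 0}
  have hV : ∀ (I : Ideal (MvPolynomial τ K)) (h : MvPolynomial τ K) (y : τ ⊕ σ → K),
      y ∈ V (I ⊔ Ideal.span {h}) ↔ y ∈ V I ∧ eval (fun i => y (Sum.inl i)) h = 0 := by
    intro I h y
    change I ⊔ Ideal.span {h} ≤ RingHom.ker (eval fun i => y (Sum.inl i)) ↔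
      I ≤ RingHom.ker (eval fun i => y (Sum.inl i)) ∧ _
    rw [sup_le_iff, Ideal.span_singleton_le_iff_mem, RingHom.mem_ker]
  have hlt : ∀ (I : Ideal (MvPolynomial τ K)) (h : MvPolynomial τ K), h ∉ I →
      I < I ⊔ Ideal.span {h} := fun I h hh =>
    left_lt_sup.2 fun hle => hh (hle (Ideal.mem_span_singleton_self h))
  suffices H : ∀ I : Ideal (MvPolynomial τ K),
      IsConstructibleIn (zariskiTopology K (τ ⊕ σ)) (V I ∩ T) by
    have := H ⊥
    rwa [Set.inter_eq_right.2] at this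
    intro y _ p hp
    rw [(Submodule.mem_bot _).1 hp, map_zero]
  intro I
  induction I using WellFoundedGT.induction with
  | ind I ih =>
  by_cases hI : I.IsPrime
  · obtain ⟨h, hh, J, HJ⟩ := exists_closure_fiber_eq_zeroLocus (σ := σ) I P g
    have key : V I ∩ T = (V (I ⊔ Ideal.span {h}) ∩ T) ∪
        ((V I ∩ {y | ∀ j ∈ J,
          eval (fun i => y (Sum.inr i)) (map (eval fun i => y (Sum.inl i)) j) = 0}) \
          {y | ∀ p ∈ ({h} : Set (MvPolynomial τ K)), eval (fun i => y (Sum.inl i)) p = 0}) := by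
      ext y
      simp only [Set.mem_inter_iff, Set.mem_union, hV, Set.mem_sdiff, Set.mem_ofPred_eq,
        Set.mem_singleton_iff, forall_eq]
      by_cases hy : y ∈ V I
      · by_cases hyh : eval (fun i => y (Sum.inl i)) h = 0
        · simp [hy, hyh]
        · simp only [hy, hyh, hT, Set.mem_ofPred_eq, HJ _ hy hyh]
          simp
      · simp [hy]
    rw [key]
    let := zariskiTopology K (τ ⊕ σ)
    exact (ih _ (hlt I h hh)).union <| .of_isClosed_diff
      ((isClosed_setOf_eval_comp_inl _).inter (isClosed_setOf_eval_map_eval J))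
      (isClosed_setOf_eval_comp_inl _)
  · rw [Ideal.isPrime_iff] at hI
    by_cases htop : I = ⊤
    · have : V I ∩ T = ∅ := by
        refine Set.eq_empty_of_forall_notMem fun y hy => ?_
        have := hy.1 1 (by rw [htop]; trivial)
        simp at this
      rw [this]
      exact ⟨0, fun _ => ∅, fun _ => ∅, fun i => i.elim0, fun i => i.elim0, by simp⟩
    · push Not at hI
      obtain ⟨a, b, hab, ha, hb⟩ := hI htop
      have key : V I ∩ T = (V (I ⊔ Ideal.span {a}) ∩ T) ∪ (V (I ⊔ Ideal.span {b}) ∩ T) := by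
        ext y
        simp only [Set.mem_inter_iff, Set.mem_union, hV]
        have : y ∈ V I → eval (fun i => y (Sum.inl i)) a = 0 ∨
            eval (fun i => y (Sum.inl i)) b = 0 := fun hy => by
          rw [← mul_eq_zero, ← map_mul]
          exact hy _ hab
        tauto
      rw [key]
      exact (ih _ (hlt I a ha)).union (ih _ (hlt I b hb))

end Families

/-- Zariski closure is definable in families over an algebraically closed field:
if `S ⊆ K^m × K^n` is constructible (the product being identified with
`K^{m+n}`, coordinates indexed by `Fin m ⊕ Fin n`), then
`{(a, x) : x ∈ closure of the fiber S_a}` is constructible. -/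
theorem zariski_closure_definable_in_families
    {K : Type*} [Field K] [IsAlgClosed K] (m n : ℕ)
    (S : Set (Fin m ⊕ Fin n → K))
    (hS : IsConstructibleIn (zariskiTopology K (Fin m ⊕ Fin n)) S) :
    IsConstructibleIn (zariskiTopology K (Fin m ⊕ Fin n))
      {y : Fin m ⊕ Fin n → K |
        (fun i => y (Sum.inr i)) ∈
          @closure _ (zariskiTopology K (Fin n))
            {x : Fin n → K | Sum.elim (fun i => y (Sum.inl i)) x ∈ S}} := by
  let := zariskiTopology K (Fin n)
  obtain ⟨r, C, D, hC, hD, rfl⟩ := hS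
  choose P hP using fun i => isClosed_zariskiTopology_iff.1 (hC i)
  choose Q hQ using fun i => isClosed_zariskiTopology_iff.1 (hD i)
  have hfin : ∀ i, ∃ s : Finset (MvPolynomial (Fin m ⊕ Fin n) K),
      D i = {x | ∀ q ∈ s, eval x q = 0} := by
    intro i
    obtain ⟨s, -, hs⟩ := (Submodule.fg_span_iff_fg_span_finset_subset (Q i)).1
      (IsNoetherian.noetherian (Ideal.span (Q i)))
    have hspan : ∀ (x : Fin m ⊕ Fin n → K) (B : Set (MvPolynomial (Fin m ⊕ Fin n) K)),
        (∀ q ∈ B, eval x q = 0) ↔ Ideal.span B ≤ RingHom.ker (eval x) := by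
      intro x B
      rw [Ideal.span_le]
      rfl
    refine ⟨s, ?_⟩
    rw [hQ i]
    ext x
    change (∀ q ∈ Q i, eval x q = 0) ↔ ∀ q ∈ (s : Set _), eval x q = 0
    rw [hspan, hspan]
    exact iff_of_eq (congrArg (· ≤ _) hs)
  choose s hs using hfin
  choose p hp using exists_eval_map_eval_eq_eval (K := K) (σ := Fin n) (τ := Fin m)
  have hp' : ∀ q (a : Fin m → K) (z : Fin n → K),
      eval z (map (eval a) (p q)) = eval (Sum.elim a z) q := fun q a z => hp q (Sum.elim a z)
  have hmem : ∀ y : Fin m ⊕ Fin n → K,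
      {x : Fin n → K | Sum.elim (fun i => y (Sum.inl i)) x ∈ ⋃ i, C i \ D i} =
      ⋃ k : Σ i, s i, {z | (∀ f ∈ p '' P k.1, eval z (map (eval fun i => y (Sum.inl i)) f) = 0) ∧
        eval z (map (eval fun i => y (Sum.inl i)) (p k.2)) ≠ 0} := by
    intro y
    ext z
    simp [-eval_map, hP, hs, hp']
  convert IsConstructibleIn.iUnion fun k : Σ i, s i =>
    isConstructibleIn_closure_fiber_basic (p '' P k.1) (p k.2) using 1
  ext y
  rw [Set.mem_iUnion, Set.mem_ofPred_eq, hmem, closure_iUnion_of_finite, Set.mem_iUnion]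
  rfl
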